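/- arXiv:1904.09148 — 8 statements merged into one kernel-verified Lean document; each statement's English description precedes it below -/
import Mathlib

section
/- Let D be a nonempty, closed and convex subset of a Euclidean space E and let T : D → D be an α-averaged operator (α ∈ (0,1)) with Fix T ≠ ∅. Then for any x₀ ∈ D, the sequence defined by x_{k+1} = T(x_k) converges to a point x* ∈ Fix T. -/
open Filter Topology

section AveragedOperator

variable {E : Type*} [NormedAddCommGroup E] [InnerProductSpace ℝ E]

lemma norm_sq_convex_combination (a : ℝ) (u v : E) :
    ‖(1 - a) • u + a • v‖ ^ 2 =
      (1 - a) * ‖u‖ ^ 2 + a * ‖v‖ ^ 2 - a * (1 - a) * ‖v - u‖ ^ 2 := by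
  rw [norm_add_sq_real, norm_sub_sq_real, norm_smul, norm_smul, mul_pow, mul_pow,
    real_inner_smul_left, real_inner_smul_right, real_inner_comm u v,
    Real.norm_eq_abs, Real.norm_eq_abs, sq_abs, sq_abs]
  ring

variable {D : Set E} {T R : E → E} {α : ℝ}

/-- The sufficient decrease property of averaged operators with respect to a fixed point. -/
lemma averaged_norm_sub_fixed_sq_le (hα : α ∈ Set.Ioo (0 : ℝ) 1)
    (hR : ∀ x ∈ D, ∀ y ∈ D, ‖R x - R y‖ ≤ ‖x - y‖)
    (hT : ∀ x ∈ D, T x = (1 - α) • x + α • R x)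
    {z : E} (hz : z ∈ D) (hTz : T z = z) {x : E} (hx : x ∈ D) :
    (1 - α) * ‖T x - x‖ ^ 2 ≤ α * (‖x - z‖ ^ 2 - ‖T x - z‖ ^ 2) := by
  obtain ⟨h0, h1⟩ := hα
  have hRz : R z = z := by
    have h : α • (R z - z) = 0 := by
      rw [← sub_eq_zero.mpr hTz, hT z hz]
      module
    exact sub_eq_zero.mp ((smul_eq_zero.mp h).resolve_left h0.ne')
  have hle : ‖R x - z‖ ^ 2 ≤ ‖x - z‖ ^ 2 := by
    have h := hR x hx z hz
    rw [hRz] at h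
    gcongr
  have hstep : ‖T x - x‖ ^ 2 = α ^ 2 * ‖R x - x‖ ^ 2 := by
    rw [show T x - x = α • (R x - x) by rw [hT x hx]; module, norm_smul, mul_pow,
      Real.norm_eq_abs, sq_abs]
  have hnorm : ‖T x - z‖ ^ 2 =
      (1 - α) * ‖x - z‖ ^ 2 + α * ‖R x - z‖ ^ 2 - α * (1 - α) * ‖R x - x‖ ^ 2 := by
    rw [show T x - z = (1 - α) • (x - z) + α • (R x - z) by rw [hT x hx]; module,
      norm_sq_convex_combination, sub_sub_sub_cancel_right]
  rw [hstep, hnorm]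
  nlinarith [mul_le_mul_of_nonneg_left hle (sq_nonneg α)]

lemma averaged_norm_sub_fixed_le (hα : α ∈ Set.Ioo (0 : ℝ) 1)
    (hR : ∀ x ∈ D, ∀ y ∈ D, ‖R x - R y‖ ≤ ‖x - y‖)
    (hT : ∀ x ∈ D, T x = (1 - α) • x + α • R x)
    {z : E} (hz : z ∈ D) (hTz : T z = z) {x : E} (hx : x ∈ D) :
    ‖T x - z‖ ≤ ‖x - z‖ := by
  have h := averaged_norm_sub_fixed_sq_le hα hR hT hz hTz hx
  have h' : 0 ≤ α * (‖x - z‖ ^ 2 - ‖T x - z‖ ^ 2) :=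
    (mul_nonneg (sub_nonneg.mpr hα.2.le) (sq_nonneg _)).trans h
  exact le_of_sq_le_sq (sub_nonneg.mp (nonneg_of_mul_nonneg_right h' hα.1)) (norm_nonneg _)

lemma averaged_continuousOn
    (hR : ∀ x ∈ D, ∀ y ∈ D, ‖R x - R y‖ ≤ ‖x - y‖)
    (hT : ∀ x ∈ D, T x = (1 - α) • x + α • R x) : ContinuousOn T D := by
  have hRc : ContinuousOn R D :=
    (LipschitzOnWith.of_dist_le_mul (K := 1) fun x hx y hy => by
      simpa [dist_eq_norm] using hR x hx y hy).continuousOn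
  exact ((continuousOn_id.const_smul (1 - α)).add (hRc.const_smul α)).congr hT

/-- Fejér monotonicity of the iterates with respect to the fixed points. -/
lemma averaged_iterate_antitone (hmaps : Set.MapsTo T D D) (hα : α ∈ Set.Ioo (0 : ℝ) 1)
    (hR : ∀ x ∈ D, ∀ y ∈ D, ‖R x - R y‖ ≤ ‖x - y‖)
    (hT : ∀ x ∈ D, T x = (1 - α) • x + α • R x)
    {z : E} (hz : z ∈ D) (hTz : T z = z) {x : E} (hx : x ∈ D) :
    Antitone fun k => ‖T^[k] x - z‖ :=
  antitone_nat_of_succ_le fun k => by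
    rw [Function.iterate_succ_apply']
    exact averaged_norm_sub_fixed_le hα hR hT hz hTz (hmaps.iterate k hx)

/-- Asymptotic regularity of averaged operators having a fixed point. -/
lemma averaged_iterate_residual_tendsto_zero (hmaps : Set.MapsTo T D D)
    (hα : α ∈ Set.Ioo (0 : ℝ) 1)
    (hR : ∀ x ∈ D, ∀ y ∈ D, ‖R x - R y‖ ≤ ‖x - y‖)
    (hT : ∀ x ∈ D, T x = (1 - α) • x + α • R x)
    {z : E} (hz : z ∈ D) (hTz : T z = z) {x : E} (hx : x ∈ D) :
    Tendsto (fun k => T (T^[k] x) - T^[k] x) atTop (𝓝 0) := by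
  have hlim := tendsto_atTop_ciInf (averaged_iterate_antitone hmaps hα hR hT hz hTz hx)
    ⟨0, Set.forall_mem_range.mpr fun _ => norm_nonneg _⟩
  have hdiff := ((hlim.pow 2).sub ((hlim.comp (tendsto_add_atTop_nat 1)).pow 2)).const_mul
    (α / (1 - α))
  rw [sub_self, mul_zero] at hdiff
  have hsq : Tendsto (fun k => ‖T (T^[k] x) - T^[k] x‖ ^ 2) atTop (𝓝 0) := by
    refine squeeze_zero (fun _ => sq_nonneg _) (fun k => ?_) hdiff
    have h := averaged_norm_sub_fixed_sq_le hα hR hT hz hTz (hmaps.iterate k hx)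
    rw [Function.comp_apply, Function.iterate_succ_apply', div_mul_eq_mul_div,
      le_div_iff₀ (sub_pos.mpr hα.2), mul_comm]
    exact h
  rw [tendsto_zero_iff_norm_tendsto_zero]
  simpa [Real.sqrt_sq (norm_nonneg _)] using hsq.sqrt

end AveragedOperator

/-- Convergence of averaged iterations: if `D` is nonempty, closed, convex,
`T : D → D` is `α`-averaged with a fixed point, then for any `x₀ ∈ D` the Banach–Picard
iterates converge to a fixed point of `T`. -/
theorem averaged_iteration_converges {E : Type*} [NormedAddCommGroup E]
    [InnerProductSpace ℝ E] [FiniteDimensional ℝ E] (D : Set E) (hD : D.Nonempty)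
    (hDclosed : IsClosed D) (hDconvex : Convex ℝ D) (T : E → E)
    (hmaps : Set.MapsTo T D D) (α : ℝ) (hα : α ∈ Set.Ioo (0 : ℝ) 1)
    (havg : ∃ R : E → E, (∀ x ∈ D, ∀ y ∈ D, ‖R x - R y‖ ≤ ‖x - y‖) ∧
      ∀ x ∈ D, T x = (1 - α) • x + α • R x)
    (hfix : ∃ x ∈ D, T x = x) :
    ∀ x₀ ∈ D, ∃ xs, xs ∈ D ∧ T xs = xs ∧
      Tendsto (fun k => T^[k] x₀) atTop (nhds xs) := by
  obtain ⟨R, hR, hT⟩ := havg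
  obtain ⟨z, hz, hTz⟩ := hfix
  intro x₀ hx₀
  have hmem : ∀ k, T^[k] x₀ ∈ D := fun k => hmaps.iterate k hx₀
  have hbdd : ∀ k, T^[k] x₀ ∈ Metric.closedBall z ‖x₀ - z‖ := fun k =>
    mem_closedBall_iff_norm.mpr
      (averaged_iterate_antitone hmaps hα hR hT hz hTz hx₀ (Nat.zero_le k))
  have := FiniteDimensional.proper_real E
  obtain ⟨xs, -, φ, hφ, hlim⟩ := (isCompact_closedBall z ‖x₀ - z‖).tendsto_subseq hbdd
  have hxs : xs ∈ D := hDclosed.mem_of_tendsto hlim (Eventually.of_forall fun k => hmem (φ k))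
  have hTlim : Tendsto (fun k => T (T^[φ k] x₀)) atTop (𝓝 (T xs)) :=
    (averaged_continuousOn hR hT xs hxs).tendsto.comp
      (tendsto_nhdsWithin_iff.mpr ⟨hlim, Eventually.of_forall fun k => hmem (φ k)⟩)
  have hres := (averaged_iterate_residual_tendsto_zero hmaps hα hR hT hz hTz hx₀).comp
    hφ.tendsto_atTop
  have hTxs : T xs = xs := sub_eq_zero.mp (tendsto_nhds_unique (hTlim.sub hlim) hres)
  refine ⟨xs, hxs, hTxs, tendsto_iff_norm_sub_tendsto_zero.mpr ?_⟩
  exact (tendsto_iff_tendsto_subseq_of_antitone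
    (averaged_iterate_antitone hmaps hα hR hT hxs hTxs hx₀) hφ.tendsto_atTop).mpr
    (tendsto_iff_norm_sub_tendsto_zero.mp hlim)
end

section
/- Let T : E → E be an α-averaged operator on a Euclidean space E for some α ∈ (0,1). Then Fix T = ∅ if and only if ‖T^k(x)‖ → ∞ as k → ∞ for every x ∈ E. -/
open Filter Topology

section Averaged

variable {E : Type*} [NormedAddCommGroup E] [InnerProductSpace ℝ E]

theorem norm_sq_one_sub_smul_add_smul (α : ℝ) (u r : E) :
    ‖(1 - α) • u + α • r‖ ^ 2 =
      (1 - α) * ‖u‖ ^ 2 + α * ‖r‖ ^ 2 - α * (1 - α) * ‖r - u‖ ^ 2 := by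
  simp only [norm_add_sq_real, norm_sub_sq_real, norm_smul, mul_pow, inner_smul_left,
    inner_smul_right, Real.norm_eq_abs, sq_abs, real_inner_comm u r, RCLike.conj_to_real]
  ring

theorem norm_sq_add_le_of_averaged {T R : E → E} {α : ℝ} (hα : 0 ≤ α)
    (hR : ∀ x y, ‖R x - R y‖ ≤ ‖x - y‖) (hT : ∀ x, T x = (1 - α) • x + α • R x) (x y : E) :
    α * ‖T x - T y‖ ^ 2 + (1 - α) * ‖(T x - x) - (T y - y)‖ ^ 2 ≤ α * ‖x - y‖ ^ 2 := by
  have h₁ : T x - T y = (1 - α) • (x - y) + α • (R x - R y) := by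
    rw [hT, hT]; module
  have h₂ : (T x - x) - (T y - y) = α • ((R x - R y) - (x - y)) := by
    rw [hT, hT]; module
  have h₃ : ‖R x - R y‖ ^ 2 ≤ ‖x - y‖ ^ 2 := by gcongr; exact hR x y
  rw [h₁, h₂, norm_sq_one_sub_smul_add_smul, norm_smul, mul_pow, Real.norm_eq_abs, sq_abs]
  nlinarith [mul_le_mul_of_nonneg_left h₃ (mul_nonneg hα hα)]

/-- An orbit cluster point of an averaged operator moves by a constant displacement. -/
theorem iterate_eq_add_smul_of_tendsto_subseq {T R : E → E} {α : ℝ} (hα : α ∈ Set.Ioo (0 : ℝ) 1)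
    (hR : ∀ x y, ‖R x - R y‖ ≤ ‖x - y‖) (hT : ∀ x, T x = (1 - α) • x + α • R x)
    (hLip : LipschitzWith 1 T) {x y : E} {φ : ℕ → ℕ} (hφ : StrictMono φ)
    (hy : Tendsto (fun i => T^[φ i] x) atTop (𝓝 y)) (n : ℕ) :
    T^[n] y = y + (n : ℝ) • (T y - y) := by
  have hanti : Antitone fun k => ‖T (T^[k] x) - T^[k] x‖ := by
    refine antitone_nat_of_succ_le fun k => ?_
    rw [Function.iterate_succ_apply']
    simpa [dist_eq_norm] using hLip.dist_le_mul (T (T^[k] x)) (T^[k] x)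
  obtain ⟨δ, hδ⟩ : ∃ δ, Tendsto (fun k => ‖T (T^[k] x) - T^[k] x‖) atTop (𝓝 δ) :=
    ⟨_, tendsto_atTop_ciInf hanti ⟨0, by rintro _ ⟨k, rfl⟩; exact norm_nonneg _⟩⟩
  have hconst (j : ℕ) : ‖T (T^[j] y) - T^[j] y‖ = δ := by
    have hc : Continuous fun z => ‖T (T^[j] z) - T^[j] z‖ := by
      have := hLip.continuous.iterate j
      have := hLip.continuous
      fun_prop
    refine tendsto_nhds_unique ((hc.tendsto y).comp hy) ?_
    refine (hδ.comp ((tendsto_add_atTop_nat j).comp hφ.tendsto_atTop)).congr fun i => ?_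
    simp only [Function.comp_apply]
    rw [Nat.add_comm, Function.iterate_add_apply]
  have hstep (j : ℕ) : T (T^[j + 1] y) - T^[j + 1] y = T (T^[j] y) - T^[j] y := by
    have h := norm_sq_add_le_of_averaged hα.1.le hR hT (T (T^[j] y)) (T^[j] y)
    have h₁ := hconst (j + 1)
    rw [Function.iterate_succ_apply'] at h₁ ⊢
    rw [h₁, hconst j] at h
    have h₂ : ‖(T (T (T^[j] y)) - T (T^[j] y)) - (T (T^[j] y) - T^[j] y)‖ ^ 2 = 0 :=
      le_antisymm (nonpos_of_mul_nonpos_right (by linarith) (sub_pos.2 hα.2)) (sq_nonneg _)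
    exact sub_eq_zero.1 (norm_eq_zero.1 (pow_eq_zero_iff two_ne_zero |>.1 h₂))
  have hdisp (j : ℕ) : T (T^[j] y) - T^[j] y = T y - y := by
    induction j with
    | zero => rfl
    | succ j ih => rw [hstep, ih]
  induction n with
  | zero => simp
  | succ n ih =>
    rw [Function.iterate_succ_apply', ← sub_add_cancel (T (T^[n] y)) (T^[n] y), hdisp, ih]
    push_cast
    module

theorem tendsto_norm_iterate_atTop_of_eq_add_smul {T : E → E} (hLip : LipschitzWith 1 T)
    {y w : E} (hw : w ≠ 0) (hy : ∀ n : ℕ, T^[n] y = y + (n : ℝ) • w) (x : E) :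
    Tendsto (fun k => ‖T^[k] x‖) atTop atTop := by
  have hlin : Tendsto (fun k : ℕ => (k : ℝ) * ‖w‖ - (‖y‖ + ‖x - y‖)) atTop atTop :=
    tendsto_atTop_add_const_right _ _
      (tendsto_natCast_atTop_atTop.atTop_mul_const (norm_pos_iff.2 hw))
  refine tendsto_atTop_mono (fun k => ?_) hlin
  have h₁ : ‖T^[k] x - T^[k] y‖ ≤ ‖x - y‖ := by
    simpa [dist_eq_norm] using (hLip.iterate k).dist_le_mul x y
  have h₂ : (k : ℝ) • w = T^[k] x - (T^[k] x - T^[k] y) - y := by rw [hy]; abel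
  have h₃ : (k : ℝ) * ‖w‖ ≤ ‖T^[k] x‖ + ‖T^[k] x - T^[k] y‖ + ‖y‖ := by
    rw [← Real.norm_natCast, ← norm_smul, h₂]
    exact (norm_sub_le _ _).trans (add_le_add_left (norm_sub_le _ _) _)
  linarith

end Averaged

/-- for an `α`-averaged operator `T : E → E`, `Fix T = ∅` iff
`‖T^k x‖ → ∞` for every `x ∈ E`. -/
theorem averaged_fixedPoints_empty_iff_norm_tendsto_atTop {E : Type*}
    [NormedAddCommGroup E] [InnerProductSpace ℝ E] [FiniteDimensional ℝ E]
    (T : E → E) (α : ℝ) (hα : α ∈ Set.Ioo (0 : ℝ) 1)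
    (havg : ∃ R : E → E, (∀ x y, ‖R x - R y‖ ≤ ‖x - y‖) ∧
      ∀ x, T x = (1 - α) • x + α • R x) :
    {x : E | T x = x} = ∅ ↔ ∀ x : E, Tendsto (fun k => ‖T^[k] x‖) atTop atTop := by
  obtain ⟨R, hR, hT⟩ := havg
  have hLip : LipschitzWith 1 T := by
    refine LipschitzWith.of_dist_le_mul fun x y => ?_
    rw [NNReal.coe_one, one_mul, dist_eq_norm, dist_eq_norm]
    have h := norm_sq_add_le_of_averaged hα.1.le hR hT x y
    have h₁ := mul_nonneg (sub_pos.2 hα.2).le (sq_nonneg ‖(T x - x) - (T y - y)‖)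
    exact le_of_sq_le_sq (le_of_mul_le_mul_left (by linarith) hα.1) (norm_nonneg _)
  constructor
  · intro hfix x
    by_contra hx
    have : ProperSpace E := FiniteDimensional.proper ℝ E
    obtain ⟨b, hb⟩ : ∃ b, ∃ᶠ k in atTop, T^[k] x ∈ Metric.ball (0 : E) b := by
      simpa [tendsto_atTop, frequently_atTop] using hx
    obtain ⟨y, -, φ, hφ, hy⟩ := tendsto_subseq_of_frequently_bounded Metric.isBounded_ball hb
    have hw : T y - y ≠ 0 := fun h => (hfix ▸ sub_eq_zero.1 h : y ∈ (∅ : Set E))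
    exact hx (tendsto_norm_iterate_atTop_of_eq_add_smul hLip hw
      (iterate_eq_add_smul_of_tendsto_subseq hα hR hT hLip hφ hy) x)
  · refine fun h => Set.eq_empty_of_forall_notMem fun x hx => ?_
    have hconst (k : ℕ) : ‖T^[k] x‖ = ‖x‖ := by rw [Function.iterate_fixed hx]
    exact not_tendsto_const_atTop ‖x‖ atTop ((h x).congr hconst)
end

section
/- Let C₁, …, C_r be nonempty, closed and convex subsets of a Euclidean space E. Then the composition P_{C_r} P_{C_{r−1}} ⋯ P_{C_1} of the projectors is α-averaged with α = 1 − 2^{−r}. -/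
open Filter Topology

/-- The composition `P (r-1) ∘ ⋯ ∘ P 1 ∘ P 0` (`P 0` applied first). -/
def compProj {E : Type*} (P : ℕ → E → E) : ℕ → E → E
  | 0 => id
  | n + 1 => P n ∘ compProj P n

theorem inner_sub_nonpos_of_norm_sub_le {E : Type*} [NormedAddCommGroup E]
    [InnerProductSpace ℝ E] {K : Set E} (hK : Convex ℝ K) {x p : E} (hp : p ∈ K)
    (hmin : ∀ c ∈ K, ‖x - p‖ ≤ ‖x - c‖) {c : E} (hc : c ∈ K) :
    inner ℝ (x - p) (c - p) ≤ 0 := by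
  have : Nonempty K := ⟨⟨p, hp⟩⟩
  refine (norm_eq_iInf_iff_real_inner_le_zero hK hp).1 (le_antisymm ?_ ?_) c hc
  · exact le_ciInf fun w => hmin w w.2
  · exact ciInf_le (f := fun w : K => ‖x - w‖)
      ⟨0, Set.forall_mem_range.2 fun _ => norm_nonneg _⟩ ⟨p, hp⟩

/-- The reflection `2 P - id` in a convex set is nonexpansive. -/
theorem norm_reflection_sub_le {E : Type*} [NormedAddCommGroup E]
    [InnerProductSpace ℝ E] {K : Set E} (hK : Convex ℝ K) {P : E → E}
    (hP : ∀ x, P x ∈ K ∧ ∀ c ∈ K, ‖x - P x‖ ≤ ‖x - c‖) (x y : E) :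
    ‖(2 : ℝ) • (P x - P y) - (x - y)‖ ≤ ‖x - y‖ := by
  have hx := inner_sub_nonpos_of_norm_sub_le hK (hP x).1 (hP x).2 (hP y).1
  have hy := inner_sub_nonpos_of_norm_sub_le hK (hP y).1 (hP y).2 (hP x).1
  refine le_of_sq_le_sq ?_ (norm_nonneg _)
  simp only [← real_inner_self_eq_norm_sq]
  simp only [inner_sub_left, inner_sub_right, inner_smul_left, inner_smul_right,
    RCLike.conj_to_real] at hx hy ⊢
  linarith [real_inner_comm x y, real_inner_comm (P x) x, real_inner_comm (P x) y,
    real_inner_comm (P y) x, real_inner_comm (P y) y, real_inner_comm (P x) (P y)]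

theorem norm_compProj_sub_sub_smul_le {E : Type*} [NormedAddCommGroup E]
    [InnerProductSpace ℝ E] {P : ℕ → E → E} (r : ℕ)
    (hP : ∀ i < r, ∀ x y, ‖(2 : ℝ) • (P i x - P i y) - (x - y)‖ ≤ ‖x - y‖) (x y : E) :
    ‖compProj P r x - compProj P r y - (1 / 2 : ℝ) ^ r • (x - y)‖
      ≤ (1 - (1 / 2 : ℝ) ^ r) * ‖x - y‖ := by
  induction r with
  | zero => simp [compProj]
  | succ n ih =>
    specialize ih fun i hi => hP i (hi.trans n.lt_succ_self)
    have hS := hP n n.lt_succ_self (compProj P n x) (compProj P n y)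
    simp only [compProj, Function.comp_apply]
    set u := compProj P n x
    set v := compProj P n y
    have hw : (0 : ℝ) ≤ (1 / 2) ^ n := by positivity
    rw [pow_succ]
    set w : ℝ := (1 / 2) ^ n
    have huv : ‖u - v‖ ≤ ‖x - y‖ := by
      have h := norm_add_le (u - v - w • (x - y)) (w • (x - y))
      rw [sub_add_cancel, norm_smul, Real.norm_of_nonneg hw] at h
      linarith
    have heq : P n u - P n v - (w * (1 / 2)) • (x - y) =
        (1 / 2 : ℝ) • (((2 : ℝ) • (P n u - P n v) - (u - v)) + (u - v - w • (x - y))) := by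
      module
    have h := norm_add_le ((2 : ℝ) • (P n u - P n v) - (u - v)) (u - v - w • (x - y))
    rw [heq, norm_smul, Real.norm_of_nonneg (by norm_num)]
    linarith

/-- the composition of the projectors onto `r` nonempty closed convex sets
is `α`-averaged with `α = 1 − 2^{−r}`. -/
theorem compProjections_averaged {E : Type*} [NormedAddCommGroup E]
    [InnerProductSpace ℝ E] [FiniteDimensional ℝ E] (r : ℕ) (hr : 0 < r)
    (C : ℕ → Set E)
    (hC : ∀ i < r, (C i).Nonempty ∧ IsClosed (C i) ∧ Convex ℝ (C i))
    (P : ℕ → E → E)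
    (hP : ∀ i < r, ∀ x, P i x ∈ C i ∧ ∀ c ∈ C i, ‖x - P i x‖ ≤ ‖x - c‖) :
    ∃ R : E → E, (∀ x y, ‖R x - R y‖ ≤ ‖x - y‖) ∧
      ∀ x, compProj P r x =
        (1 - (1 - (1 / 2 : ℝ) ^ r)) • x + (1 - (1 / 2 : ℝ) ^ r) • R x := by
  have ha : 0 < 1 - (1 / 2 : ℝ) ^ r :=
    sub_pos.2 (pow_lt_one₀ (by norm_num) (by norm_num) hr.ne')
  have hT := norm_compProj_sub_sub_smul_le r
    fun i hi => norm_reflection_sub_le (hC i hi).2.2 (hP i hi)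
  set w : ℝ := (1 / 2) ^ r
  refine ⟨fun x => (1 - w)⁻¹ • (compProj P r x - w • x), fun x y => ?_, fun x => ?_⟩
  · rw [← smul_sub, norm_smul, norm_inv, Real.norm_of_nonneg ha.le, inv_mul_le_iff₀ ha]
    simpa only [smul_sub, sub_sub_sub_comm] using hT x y
  · rw [smul_inv_smul₀ ha.ne']
    module
end

section
/- Let C₁, C₂, …, C_r be closed and convex subsets of a Euclidean space E with nonempty intersection. Then the fixed point set of the composition P_{C_r} P_{C_{r−1}} ⋯ P_{C_1} equals C₁ ∩ C₂ ∩ … ∩ C_r. -/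
open Filter Topology

/-- Pythagorean inequality for a nearest point of a convex set. -/
theorem norm_sub_sq_add_norm_sub_sq_le_of_nearest {E : Type*} [NormedAddCommGroup E]
    [InnerProductSpace ℝ E] {K : Set E} (hK : Convex ℝ K) {x p c : E} (hp : p ∈ K)
    (hmin : ∀ w ∈ K, ‖x - p‖ ≤ ‖x - w‖) (hc : c ∈ K) :
    ‖p - c‖ ^ 2 + ‖x - p‖ ^ 2 ≤ ‖x - c‖ ^ 2 := by
  have : Nonempty K := ⟨⟨p, hp⟩⟩
  have hinf : ‖x - p‖ = ⨅ w : K, ‖x - w‖ :=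
    le_antisymm (le_ciInf fun w => hmin w w.2)
      (ciInf_le (f := fun w : K => ‖x - w‖)
        ⟨0, Set.forall_mem_range.2 fun _ => norm_nonneg _⟩ ⟨p, hp⟩)
  have hinner := (norm_eq_iInf_iff_real_inner_le_zero hK hp).1 hinf c hc
  have hexp := norm_sub_sq_real (x - p) (c - p)
  rw [sub_sub_sub_cancel_right, norm_sub_rev c p] at hexp
  linarith

/-- The composition of projectors does not increase the distance to a common point `c`, and it
preserves this distance only at points of all the sets, which it fixes. -/
theorem norm_compProj_sub_le {E : Type*} [NormedAddCommGroup E] [InnerProductSpace ℝ E]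
    {C : ℕ → Set E} {P : ℕ → E → E} {c : E} (n : ℕ) (hC : ∀ i < n, Convex ℝ (C i))
    (hP : ∀ i < n, ∀ x, P i x ∈ C i ∧ ∀ w ∈ C i, ‖x - P i x‖ ≤ ‖x - w‖)
    (hc : ∀ i < n, c ∈ C i) (x : E) :
    ‖compProj P n x - c‖ ≤ ‖x - c‖ ∧
      (‖x - c‖ ≤ ‖compProj P n x - c‖ → compProj P n x = x ∧ ∀ i < n, x ∈ C i) := by
  induction n with
  | zero => simp [compProj]
  | succ n ih =>
    obtain ⟨hle, heq⟩ := ih (fun i hi => hC i (by lia)) (fun i hi => hP i (by lia))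
      (fun i hi => hc i (by lia))
    set y := compProj P n x
    have hPn := hP n n.lt_succ_self y
    have hpyth := norm_sub_sq_add_norm_sub_sq_le_of_nearest (hC n n.lt_succ_self) hPn.1 hPn.2
      (hc n n.lt_succ_self)
    have hstep : ‖P n y - c‖ ≤ ‖y - c‖ :=
      (sq_le_sq₀ (norm_nonneg _) (norm_nonneg _)).1 (by nlinarith [sq_nonneg ‖y - P n y‖])
    change ‖P n y - c‖ ≤ ‖x - c‖ ∧
      (‖x - c‖ ≤ ‖P n y - c‖ → P n y = x ∧ ∀ i < n + 1, x ∈ C i)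
    refine ⟨hstep.trans hle, fun h => ?_⟩
    obtain ⟨hyx, hmem⟩ := heq (h.trans hstep)
    rw [hyx] at hpyth hPn hstep ⊢
    have hnorm : ‖P n x - c‖ = ‖x - c‖ := le_antisymm hstep (hyx ▸ h)
    rw [hnorm] at hpyth
    have hfix : P n x = x := by
      have : ‖x - P n x‖ = 0 := by
        nlinarith [norm_nonneg (x - P n x)]
      exact (sub_eq_zero.1 (norm_eq_zero.1 this)).symm
    refine ⟨hfix, fun i hi => ?_⟩
    rcases Nat.lt_succ_iff_lt_or_eq.1 hi with hi | rfl
    · exact hmem i hi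
    · exact hfix ▸ hPn.1

/-- A point fixed by every factor is fixed by the composition. -/
theorem compProj_eq_self {E : Type*} {P : ℕ → E → E} {x : E} (n : ℕ)
    (h : ∀ i < n, P i x = x) : compProj P n x = x := by
  induction n with
  | zero => rfl
  | succ n ih =>
    change P n (compProj P n x) = x
    rw [ih fun i hi => h i (by lia), h n n.lt_succ_self]

/-- for closed convex sets `C 0, …, C (r-1)` with nonempty intersection, the
fixed point set of the composition of the projectors equals the intersection. -/
theorem fixedPoints_compProjections {E : Type*} [NormedAddCommGroup E]
    [InnerProductSpace ℝ E] [FiniteDimensional ℝ E] (r : ℕ) (hr : 0 < r)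
    (C : ℕ → Set E)
    (hC : ∀ i < r, IsClosed (C i) ∧ Convex ℝ (C i))
    (hne : (⋂ i < r, C i).Nonempty)
    (P : ℕ → E → E)
    (hP : ∀ i < r, ∀ x, P i x ∈ C i ∧ ∀ c ∈ C i, ‖x - P i x‖ ≤ ‖x - c‖) :
    {x : E | compProj P r x = x} = ⋂ i < r, C i := by
  obtain ⟨c, hc⟩ := hne
  simp only [Set.mem_iInter] at hc
  ext x
  simp only [Set.mem_ofPred_eq, Set.mem_iInter]
  constructor
  · intro hx
    exact ((norm_compProj_sub_le r (fun i hi => (hC i hi).2) hP hc x).2 (by rw [hx])).2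
  · intro hx
    refine compProj_eq_self r fun i hi => ?_
    have h := (hP i hi x).2 x (hx i hi)
    rw [sub_self, norm_zero, norm_le_zero_iff] at h
    exact (sub_eq_zero.1 h).symm
end

section
/- Let C₁, C₂, …, C_r be closed and convex subsets of a Euclidean space E with nonempty intersection. Given any x₀ ∈ E, the sequence generated by x_{k+1} = (P_{C_r} P_{C_{r−1}} ⋯ P_{C_1})(x_k) converges to a point x* ∈ C₁ ∩ C₂ ∩ … ∩ C_r. -/
open Filter Topology

open scoped RealInnerProductSpace

section NearestPoint

variable {E : Type*} [NormedAddCommGroup E] [InnerProductSpace ℝ E]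

theorem inner_sub_nearest_nonpos {K : Set E} (hK : Convex ℝ K) {x p : E} (hp : p ∈ K)
    (hmin : ∀ c ∈ K, ‖x - p‖ ≤ ‖x - c‖) {z : E} (hz : z ∈ K) : ⟪x - p, z - p⟫ ≤ 0 := by
  have hinf : ‖x - p‖ = ⨅ w : K, ‖x - w‖ := by
    have : Nonempty K := ⟨⟨p, hp⟩⟩
    exact le_antisymm (le_ciInf fun w => hmin w w.2)
      (ciInf_le ⟨0, by rintro _ ⟨w, rfl⟩; positivity⟩ (⟨p, hp⟩ : K))
  exact (norm_eq_iInf_iff_real_inner_le_zero hK hp).1 hinf z hz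

theorem norm_nearest_sub_sq_add_le {K : Set E} (hK : Convex ℝ K) {x p : E} (hp : p ∈ K)
    (hmin : ∀ c ∈ K, ‖x - p‖ ≤ ‖x - c‖) {z : E} (hz : z ∈ K) :
    ‖p - z‖ ^ 2 + ‖x - p‖ ^ 2 ≤ ‖x - z‖ ^ 2 := by
  have h := inner_sub_nearest_nonpos hK hp hmin hz
  have e := norm_sub_sq_real (x - p) (z - p)
  rw [sub_sub_sub_cancel_right, norm_sub_rev z p] at e
  linarith

theorem lipschitzWith_one_of_nearest {K : Set E} (hK : Convex ℝ K) {p : E → E}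
    (hp : ∀ x, p x ∈ K ∧ ∀ c ∈ K, ‖x - p x‖ ≤ ‖x - c‖) : LipschitzWith 1 p := by
  refine LipschitzWith.of_dist_le_mul fun x y => ?_
  rw [NNReal.coe_one, one_mul, dist_eq_norm, dist_eq_norm]
  have hx := inner_sub_nearest_nonpos hK (hp x).1 (hp x).2 (hp y).1
  have hy := inner_sub_nearest_nonpos hK (hp y).1 (hp y).2 (hp x).1
  have e : ⟪x - y, p x - p y⟫ = ‖p x - p y‖ ^ 2 - ⟪x - p x, p y - p x⟫
      - ⟪y - p y, p x - p y⟫ := by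
    rw [← real_inner_self_eq_norm_sq]
    simp only [inner_sub_left, inner_sub_right]
    ring
  have hcs := real_inner_le_norm (x - y) (p x - p y)
  by_contra! hlt
  nlinarith [norm_nonneg (x - y), norm_nonneg (p x - p y)]

theorem continuous_compProj {C : ℕ → Set E} {P : ℕ → E → E} (n : ℕ)
    (hC : ∀ i < n, Convex ℝ (C i))
    (hP : ∀ i < n, ∀ x, P i x ∈ C i ∧ ∀ c ∈ C i, ‖x - P i x‖ ≤ ‖x - c‖) :
    Continuous (compProj P n) := by
  induction n with
  | zero => exact continuous_id
  | succ n ih =>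
    exact (lipschitzWith_one_of_nearest (hC n n.lt_succ_self)
      (hP n n.lt_succ_self)).continuous.comp
      (ih (fun i hi => hC i (hi.trans n.lt_succ_self)) fun i hi => hP i (hi.trans n.lt_succ_self))

theorem compProj_norm_sub_le {C : ℕ → Set E} {P : ℕ → E → E} (n : ℕ)
    (hC : ∀ i < n, Convex ℝ (C i))
    (hP : ∀ i < n, ∀ x, P i x ∈ C i ∧ ∀ c ∈ C i, ‖x - P i x‖ ≤ ‖x - c‖)
    {z : E} (hz : ∀ i < n, z ∈ C i) (x : E) :
    ‖compProj P n x - z‖ ≤ ‖x - z‖ ∧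
      (‖x - z‖ ≤ ‖compProj P n x - z‖ → compProj P n x = x ∧ ∀ i < n, x ∈ C i) := by
  induction n with
  | zero => simp [compProj]
  | succ n ih =>
    obtain ⟨hle, heq⟩ := ih (fun i hi => hC i (hi.trans n.lt_succ_self))
      (fun i hi => hP i (hi.trans n.lt_succ_self)) fun i hi => hz i (hi.trans n.lt_succ_self)
    have hPn := hP n n.lt_succ_self (compProj P n x)
    have hsq := norm_nearest_sub_sq_add_le (hC n n.lt_succ_self) hPn.1 hPn.2
      (hz n n.lt_succ_self)
    change ‖P n (compProj P n x) - z‖ ≤ ‖x - z‖ ∧ (‖x - z‖ ≤ ‖P n (compProj P n x) - z‖ →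
      P n (compProj P n x) = x ∧ ∀ i < n + 1, x ∈ C i)
    have hstep : ‖P n (compProj P n x) - z‖ ≤ ‖compProj P n x - z‖ :=
      (sq_le_sq₀ (norm_nonneg _) (norm_nonneg _)).1
        (by linarith [sq_nonneg ‖compProj P n x - P n (compProj P n x)‖])
    refine ⟨hstep.trans hle, fun hge => ?_⟩
    obtain ⟨hfix, hmem⟩ := heq (hge.trans hstep)
    rw [hfix] at hsq hPn hge ⊢
    have hzero : ‖x - P n x‖ = 0 := by
      have := pow_le_pow_left₀ (norm_nonneg _) hge 2
      exact pow_eq_zero_iff two_ne_zero |>.1 (le_antisymm (by linarith) (sq_nonneg _))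
    have hPx : P n x = x := (sub_eq_zero.1 (norm_eq_zero.1 hzero)).symm
    refine ⟨hPx, fun i hi => ?_⟩
    rcases Nat.lt_succ_iff_lt_or_eq.1 hi with hi | rfl
    · exact hmem i hi
    · exact hPx ▸ hPn.1

end NearestPoint

/-- Iterates of a continuous map that is strictly Fejér monotone with respect to a nonempty set
converge to a point of that set. -/
theorem exists_tendsto_iterate_of_dist_le {X : Type*} [MetricSpace X] [ProperSpace X]
    {T : X → X} (hT : Continuous T) {F : Set X} (hF : F.Nonempty)
    (hle : ∀ z ∈ F, ∀ x, dist (T x) z ≤ dist x z)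
    (hmem : ∀ z ∈ F, ∀ x, dist x z ≤ dist (T x) z → x ∈ F) (x₀ : X) :
    ∃ a ∈ F, Tendsto (fun k => T^[k] x₀) atTop (𝓝 a) := by
  have hanti : ∀ z ∈ F, Antitone fun k => dist (T^[k] x₀) z := fun z hz =>
    antitone_nat_of_succ_le fun k => by
      rw [Function.iterate_succ_apply']
      exact hle z hz _
  have hlim : ∀ z ∈ F, ∃ L, Tendsto (fun k => dist (T^[k] x₀) z) atTop (𝓝 L) := fun z hz =>
    ⟨_, tendsto_atTop_ciInf (hanti z hz) ⟨0, by rintro _ ⟨k, rfl⟩; exact dist_nonneg⟩⟩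
  obtain ⟨z, hz⟩ := hF
  obtain ⟨a, -, φ, hφ, ha⟩ := (isCompact_closedBall z (dist x₀ z)).tendsto_subseq
    (x := fun k => T^[k] x₀) fun k => hanti z hz k.zero_le
  have haF : a ∈ F := by
    obtain ⟨L, hL⟩ := hlim z hz
    have h₁ : dist a z = L :=
      tendsto_nhds_unique (ha.dist tendsto_const_nhds) (hL.comp hφ.tendsto_atTop)
    have h₂ : dist (T a) z = L := by
      refine tendsto_nhds_unique (((hT.tendsto a).comp ha).dist tendsto_const_nhds)
        (((hL.comp (tendsto_add_atTop_nat 1)).comp hφ.tendsto_atTop).congr fun k => ?_)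
      simp only [Function.comp_apply, Function.iterate_succ_apply']
    exact hmem z hz a (h₁.trans h₂.symm).le
  refine ⟨a, haF, tendsto_iff_dist_tendsto_zero.2 ?_⟩
  obtain ⟨L, hL⟩ := hlim a haF
  have hL0 : L = 0 := tendsto_nhds_unique (hL.comp hφ.tendsto_atTop)
    (tendsto_iff_dist_tendsto_zero.1 ha)
  exact hL0 ▸ hL

/-- Method of cyclic projections: for closed convex sets with nonempty
intersection, the iterates of the composed projector converge to a point in the
intersection. -/
theorem cyclic_projections_converge {E : Type*} [NormedAddCommGroup E]
    [InnerProductSpace ℝ E] [FiniteDimensional ℝ E] (r : ℕ) (hr : 0 < r)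
    (C : ℕ → Set E)
    (hC : ∀ i < r, IsClosed (C i) ∧ Convex ℝ (C i))
    (hne : (⋂ i < r, C i).Nonempty)
    (P : ℕ → E → E)
    (hP : ∀ i < r, ∀ x, P i x ∈ C i ∧ ∀ c ∈ C i, ‖x - P i x‖ ≤ ‖x - c‖) :
    ∀ x₀ : E, ∃ xs ∈ ⋂ i < r, C i,
      Tendsto (fun k => (compProj P r)^[k] x₀) atTop (nhds xs) := by
  have hCc : ∀ i < r, Convex ℝ (C i) := fun i hi => (hC i hi).2
  have : ProperSpace E := FiniteDimensional.proper ℝ E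
  refine exists_tendsto_iterate_of_dist_le (continuous_compProj r hCc hP) hne ?_ ?_
  · intro z hz x
    rw [dist_eq_norm, dist_eq_norm]
    exact (compProj_norm_sub_le r hCc hP (Set.mem_iInter₂.1 hz) x).1
  · intro z hz x h
    rw [dist_eq_norm, dist_eq_norm] at h
    exact Set.mem_iInter₂.2 ((compProj_norm_sub_le r hCc hP (Set.mem_iInter₂.1 hz) x).2 h).2
end

section
/- Let A and B be nonempty, closed and convex subsets of a Euclidean space E and let T_{A,B} = (Id + R_B R_A)/2 be the Douglas–Rachford operator. Then Fix T_{A,B} ≠ ∅ if and only if A ∩ B ≠ ∅, and moreover P_A(x) ∈ A ∩ B for every x ∈ Fix T_{A,B} (indeed P_A(Fix T_{A,B}) = A ∩ B). -/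
open Filter Topology

/-- fixed points of the Douglas–Rachford operator: `Fix T_{A,B} ≠ ∅` iff
`A ∩ B ≠ ∅`, `P_A x ∈ A ∩ B` for every fixed point `x`, and `P_A (Fix T_{A,B}) = A ∩ B`. -/
theorem DR_fixedPoints {E : Type*} [NormedAddCommGroup E] [InnerProductSpace ℝ E]
    [FiniteDimensional ℝ E] (A B : Set E)
    (hA : A.Nonempty) (hAclosed : IsClosed A) (hAconvex : Convex ℝ A)
    (hB : B.Nonempty) (hBclosed : IsClosed B) (hBconvex : Convex ℝ B)
    (PA PB : E → E)
    (hPA : ∀ x, PA x ∈ A ∧ ∀ c ∈ A, ‖x - PA x‖ ≤ ‖x - c‖)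
    (hPB : ∀ x, PB x ∈ B ∧ ∀ c ∈ B, ‖x - PB x‖ ≤ ‖x - c‖)
    (T : E → E)
    (hT : ∀ x, T x = (1 / 2 : ℝ) •
      (x + ((2 : ℝ) • PB ((2 : ℝ) • PA x - x) - ((2 : ℝ) • PA x - x)))) :
    ((∃ x, T x = x) ↔ (A ∩ B).Nonempty) ∧
      (∀ x, T x = x → PA x ∈ A ∩ B) ∧
      PA '' {x : E | T x = x} = A ∩ B := by
  have eq_of_nearest : ∀ {C : Set E} {P : E → E},
      (∀ x, P x ∈ C ∧ ∀ c ∈ C, ‖x - P x‖ ≤ ‖x - c‖) → ∀ x ∈ C, P x = x := by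
    intro C P hP x hx
    have h := (hP x).2 x hx
    rw [sub_self, norm_zero, norm_le_zero_iff, sub_eq_zero] at h
    exact h.symm
  have mem_inter_of_fixed : ∀ x, T x = x → PA x ∈ A ∩ B := by
    intro x hx
    have h : PB ((2 : ℝ) • PA x - x) = PA x := by
      have h₁ : PB ((2 : ℝ) • PA x - x) - PA x = T x - x := by
        rw [hT]
        module
      rwa [hx, sub_self, sub_eq_zero] at h₁
    exact ⟨(hPA x).1, h ▸ (hPB ((2 : ℝ) • PA x - x)).1⟩
  have fixed_of_mem_inter : ∀ x ∈ A ∩ B, T x = x := by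
    rintro x ⟨hxA, hxB⟩
    have h : (2 : ℝ) • x - x = x := by module
    rw [hT, eq_of_nearest hPA x hxA, h, eq_of_nearest hPB x hxB]
    module
  refine ⟨⟨fun ⟨x, hx⟩ => ⟨PA x, mem_inter_of_fixed x hx⟩,
    fun ⟨x, hx⟩ => ⟨x, fixed_of_mem_inter x hx⟩⟩, mem_inter_of_fixed, ?_⟩
  exact Set.Subset.antisymm (Set.image_subset_iff.2 mem_inter_of_fixed)
    fun x hx => ⟨x, fixed_of_mem_inter x hx, eq_of_nearest hPA x hx.1⟩
end

section
/- Let A and B be nonempty, closed and convex subsets of a Euclidean space E, let x₀ ∈ E, and define x_{k+1} = T_{A,B}(x_k) where T_{A,B} = (Id + R_B R_A)/2. Exactly one of the following holds: (i) A ∩ B ≠ ∅ and (x_k) converges to a point x* with T_{A,B}(x*) = x* and P_A(x*) ∈ A ∩ B; (ii) A ∩ B = ∅ and ‖x_k‖ → +∞. -/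
open Filter Topology

section Projection

variable {E : Type*} [NormedAddCommGroup E] [InnerProductSpace ℝ E] {C : Set E} {P : E → E}

/-- A nearest point of a convex set satisfies the variational inequality. -/
lemma inner_sub_nearest_le_zero (hC : Convex ℝ C)
    (hP : ∀ x, P x ∈ C ∧ ∀ c ∈ C, ‖x - P x‖ ≤ ‖x - c‖) (x : E) {c : E} (hc : c ∈ C) :
    inner ℝ (x - P x) (c - P x) ≤ 0 := by
  refine (norm_eq_iInf_iff_real_inner_le_zero hC (hP x).1).1 (le_antisymm ?_ ?_) c hc
  · have : Nonempty C := ⟨⟨c, hc⟩⟩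
    exact le_ciInf fun w => (hP x).2 w w.2
  · exact ciInf_le ⟨0, by rintro _ ⟨w, rfl⟩; exact norm_nonneg _⟩ (⟨P x, (hP x).1⟩ : C)

/-- The projector onto a convex set is firmly nonexpansive. -/
lemma inner_nearest_sub_nonneg (hC : Convex ℝ C)
    (hP : ∀ x, P x ∈ C ∧ ∀ c ∈ C, ‖x - P x‖ ≤ ‖x - c‖) (x y : E) :
    0 ≤ inner ℝ (P x - P y) ((x - y) - (P x - P y)) := by
  have h₁ := inner_sub_nearest_le_zero hC hP x (hP y).1
  have h₂ := inner_sub_nearest_le_zero hC hP y (hP x).1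
  have key : inner ℝ (P x - P y) ((x - y) - (P x - P y)) =
      -inner ℝ (x - P x) (P y - P x) - inner ℝ (y - P y) (P x - P y) := by
    rw [← neg_sub (P x) (P y), inner_neg_right, neg_neg, ← inner_sub_left, real_inner_comm]
    congr 1
    abel
  linarith

end Projection

lemma nearest_eq_self {E : Type*} [NormedAddCommGroup E] {C : Set E} {P : E → E}
    (hP : ∀ x, P x ∈ C ∧ ∀ c ∈ C, ‖x - P x‖ ≤ ‖x - c‖) {c : E} (hc : c ∈ C) : P c = c := by
  have h := (hP c).2 c hc
  rw [sub_self, norm_zero, norm_le_zero_iff, sub_eq_zero] at h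
  exact h.symm

section FirmlyNonexpansive

variable {E : Type*} [NormedAddCommGroup E] {T : E → E}

lemma lipschitzWith_one_of_firm
    (hT : ∀ x y, ‖T x - T y‖ ^ 2 + ‖(x - T x) - (y - T y)‖ ^ 2 ≤ ‖x - y‖ ^ 2) :
    LipschitzWith 1 T := by
  refine LipschitzWith.of_dist_le_mul fun x y => ?_
  rw [NNReal.coe_one, one_mul, dist_eq_norm, dist_eq_norm]
  refine le_of_sq_le_sq ?_ (norm_nonneg _)
  nlinarith [hT x y, sq_nonneg ‖(x - T x) - (y - T y)‖]

lemma dist_iterate_le_of_lipschitz (hT : LipschitzWith 1 T) (n : ℕ) (x y : E) :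
    dist (T^[n] x) (T^[n] y) ≤ dist x y := by
  simpa using (hT.iterate n).dist_le_mul x y

/-- A cluster point of an orbit of a firmly nonexpansive map is a fixed point. -/
lemma isFixedPt_of_tendsto_subseq_of_firm [NormedSpace ℝ E]
    (hT : ∀ x y, ‖T x - T y‖ ^ 2 + ‖(x - T x) - (y - T y)‖ ^ 2 ≤ ‖x - y‖ ^ 2)
    {x y : E} {φ : ℕ → ℕ} (hφ : StrictMono φ)
    (hy : Tendsto (fun j => T^[φ j] x) atTop (𝓝 y)) : T y = y := by
  have hlip := lipschitzWith_one_of_firm hT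
  have hanti : Antitone fun k => dist (T^[k] x) (T (T^[k] x)) := by
    refine antitone_nat_of_succ_le fun k => ?_
    simpa [Function.iterate_succ_apply'] using hlip.dist_le_mul (T^[k] x) (T (T^[k] x))
  have hlim := tendsto_atTop_ciInf hanti ⟨0, by rintro _ ⟨k, rfl⟩; exact dist_nonneg⟩
  have hstep_norm (n : ℕ) : dist (T^[n] y) (T (T^[n] y)) =
      ⨅ k, dist (T^[k] x) (T (T^[k] x)) := by
    have hn : Tendsto (fun j => T^[n] (T^[φ j] x)) atTop (𝓝 (T^[n] y)) :=
      ((hlip.continuous.iterate n).tendsto y).comp hy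
    refine tendsto_nhds_unique (hn.dist ((hlip.continuous.tendsto _).comp hn)) ?_
    have hsub : Tendsto (fun j => n + φ j) atTop atTop :=
      tendsto_atTop_mono (fun j => Nat.le_add_left _ _) hφ.tendsto_atTop
    simpa [Function.comp_def, Function.iterate_add_apply] using hlim.comp hsub
  have hstep (n : ℕ) : T^[n] y - T (T^[n] y) = y - T y := by
    induction n with
    | zero => rfl
    | succ n ih =>
      rw [← ih, Function.iterate_succ_apply']
      have h := hT (T^[n] y) (T (T^[n] y))
      have h₀ := (hstep_norm n).trans (hstep_norm (n + 1)).symm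
      rw [Function.iterate_succ_apply', dist_eq_norm, dist_eq_norm] at h₀
      rw [h₀] at h
      have hz : ‖T^[n] y - T (T^[n] y) - (T (T^[n] y) - T (T (T^[n] y)))‖ = 0 :=
        pow_eq_zero_iff two_ne_zero |>.1 (le_antisymm (by linarith) (sq_nonneg _))
      exact (sub_eq_zero.1 (norm_eq_zero.1 hz)).symm
  have hiter (n : ℕ) : y - T^[n] y = n • (y - T y) := by
    induction n with
    | zero => simp
    | succ n ih => rw [succ_nsmul, ← ih, ← hstep n, Function.iterate_succ_apply']; abel
  by_contra hne
  have hpos : 0 < dist y (T y) := dist_pos.2 (Ne.symm hne)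
  obtain ⟨N, hN⟩ := Metric.tendsto_atTop.1 hy (dist y (T y) / 2) (half_pos hpos)
  obtain ⟨m, hm⟩ := Nat.exists_eq_add_of_lt (hφ N.lt_succ_self)
  have hm' : φ (N + 1) = (m + 1) + φ N := by rw [hm]; omega
  have h₁ := hN N le_rfl
  have h₂ := hN (N + 1) N.le_succ
  rw [hm', Function.iterate_add_apply] at h₂
  have h₃ := dist_iterate_le_of_lipschitz hlip (m + 1) (T^[φ N] x) y
  have h₄ := dist_triangle_left y (T^[m + 1] y) (T^[m + 1] (T^[φ N] x))
  have h₅ : dist y (T y) ≤ dist y (T^[m + 1] y) := by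
    rw [dist_eq_norm, dist_eq_norm, hiter, RCLike.norm_nsmul ℝ, nsmul_eq_mul]
    exact le_mul_of_one_le_left (norm_nonneg _) (by simp)
  linarith

/-- An orbit of a firmly nonexpansive map of a proper space either tends to infinity or
converges to a fixed point. -/
lemma tendsto_norm_iterate_atTop_or_tendsto_fixedPt [NormedSpace ℝ E]
    [ProperSpace E]
    (hT : ∀ x y, ‖T x - T y‖ ^ 2 + ‖(x - T x) - (y - T y)‖ ^ 2 ≤ ‖x - y‖ ^ 2) (x : E) :
    Tendsto (fun k => ‖T^[k] x‖) atTop atTop ∨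
      ∃ y, T y = y ∧ Tendsto (fun k => T^[k] x) atTop (𝓝 y) := by
  refine or_iff_not_imp_left.2 fun hinf => ?_
  obtain ⟨r, hr⟩ : ∃ r, ∃ᶠ k in atTop, T^[k] x ∈ Metric.closedBall (0 : E) r := by
    rw [tendsto_atTop] at hinf
    push Not at hinf
    obtain ⟨r, hr⟩ := hinf
    exact ⟨r, hr.mono fun k hk => by simpa using hk.le⟩
  obtain ⟨y, -, φ, hφ, hy⟩ := tendsto_subseq_of_frequently_bounded Metric.isBounded_closedBall hr
  have hfix : T y = y := isFixedPt_of_tendsto_subseq_of_firm hT hφ hy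
  refine ⟨y, hfix, ?_⟩
  have hanti : Antitone fun k => dist (T^[k] x) y := by
    refine antitone_nat_of_succ_le fun k => ?_
    simpa [Function.iterate_succ_apply', hfix] using
      (lipschitzWith_one_of_firm hT).dist_le_mul (T^[k] x) y
  rw [tendsto_iff_dist_tendsto_zero] at hy ⊢
  exact (tendsto_iff_tendsto_subseq_of_antitone hanti hφ.tendsto_atTop).2 hy

end FirmlyNonexpansive

/-- Douglas–Rachford dichotomy: either `A ∩ B ≠ ∅` and the DR iterates
converge to a fixed point `x*` with `P_A x* ∈ A ∩ B`, or `A ∩ B = ∅` and `‖x_k‖ → ∞`. -/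
theorem DR_dichotomy {E : Type*} [NormedAddCommGroup E] [InnerProductSpace ℝ E]
    [FiniteDimensional ℝ E] (A B : Set E)
    (hA : A.Nonempty) (hAclosed : IsClosed A) (hAconvex : Convex ℝ A)
    (hB : B.Nonempty) (hBclosed : IsClosed B) (hBconvex : Convex ℝ B)
    (PA PB : E → E)
    (hPA : ∀ x, PA x ∈ A ∧ ∀ c ∈ A, ‖x - PA x‖ ≤ ‖x - c‖)
    (hPB : ∀ x, PB x ∈ B ∧ ∀ c ∈ B, ‖x - PB x‖ ≤ ‖x - c‖)
    (T : E → E)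
    (hT : ∀ x, T x = (1 / 2 : ℝ) •
      (x + ((2 : ℝ) • PB ((2 : ℝ) • PA x - x) - ((2 : ℝ) • PA x - x))))
    (x₀ : E) :
    ((A ∩ B).Nonempty ∧ ∃ xs, T xs = xs ∧ PA xs ∈ A ∩ B ∧
        Tendsto (fun k => T^[k] x₀) atTop (nhds xs)) ∨
      (A ∩ B = ∅ ∧ Tendsto (fun k => ‖T^[k] x₀‖) atTop atTop) := by
  have : ProperSpace E := FiniteDimensional.proper ℝ E
  have hT' (x : E) : T x = x + PB ((2 : ℝ) • PA x - x) - PA x := by rw [hT]; module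
  have hfirm (x y : E) : ‖T x - T y‖ ^ 2 + ‖(x - T x) - (y - T y)‖ ^ 2 ≤ ‖x - y‖ ^ 2 := by
    have hp := inner_nearest_sub_nonneg hAconvex hPA x y
    have hq := inner_nearest_sub_nonneg hBconvex hPB
      ((2 : ℝ) • PA x - x) ((2 : ℝ) • PA y - y)
    rw [hT' x, hT' y]
    generalize PB ((2 : ℝ) • PA x - x) = u at *
    generalize PB ((2 : ℝ) • PA y - y) = v at *
    have e₁ : x + u - PA x - (y + v - PA y) = (x - y) + (u - v) - (PA x - PA y) := by abel
    have e₂ : x - (x + u - PA x) - (y - (y + v - PA y)) = (PA x - PA y) - (u - v) := by abel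
    have e₃ : (2 : ℝ) • PA x - x - ((2 : ℝ) • PA y - y) - (u - v) =
        (2 : ℝ) • (PA x - PA y) - (x - y) - (u - v) := by module
    rw [e₃] at hq
    rw [e₁, e₂]
    generalize PA x - PA y = p at *
    generalize u - v = q at *
    generalize x - y = w at *
    simp only [← real_inner_self_eq_norm_sq, inner_add_left, inner_add_right, inner_sub_left,
      inner_sub_right, inner_smul_right] at *
    linarith [real_inner_comm p q, real_inner_comm p w, real_inner_comm q w]
  have hfix {x : E} (hx : T x = x) : PA x ∈ A ∩ B := by
    have h : PB ((2 : ℝ) • PA x - x) = PA x := by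
      rw [hT', add_sub_assoc, add_eq_left, sub_eq_zero] at hx
      exact hx
    exact ⟨(hPA x).1, h ▸ (hPB _).1⟩
  rcases (A ∩ B).eq_empty_or_nonempty with hAB | ⟨c, hc⟩
  · refine Or.inr ⟨hAB, ?_⟩
    rcases tendsto_norm_iterate_atTop_or_tendsto_fixedPt hfirm x₀ with h | ⟨y, hy, -⟩
    · exact h
    · exact absurd (hfix hy) (by simp [hAB])
  · refine Or.inl ⟨⟨c, hc⟩, ?_⟩
    rcases tendsto_norm_iterate_atTop_or_tendsto_fixedPt hfirm x₀ with h | ⟨y, hy, hlim⟩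
    · have hTc : T c = c := by
        have h₂ : (2 : ℝ) • c - c = c := by module
        rw [hT', nearest_eq_self hPA hc.1, h₂, nearest_eq_self hPB hc.2, add_sub_cancel_right]
      obtain ⟨k, hk⟩ := (h.eventually_gt_atTop (dist x₀ c + ‖c‖)).exists
      have hd := dist_iterate_le_of_lipschitz (lipschitzWith_one_of_firm hfirm) k x₀ c
      rw [Function.iterate_fixed hTc, dist_eq_norm] at hd
      linarith [norm_le_norm_sub_add (T^[k] x₀) c]
    · exact ⟨y, hy, hfix hy, hlim⟩
end

section
/- Let C₁, C₂, …, C_r be closed and convex subsets of a Euclidean space E with nonempty intersection. Given x₀ ∈ E, the method of averaged projections, x_{k+1} = T(x_k) with T = (P_{C₁} + P_{C₂} + ⋯ + P_{C_r})/r, generates a sequence (x_k) converging to a point in C₁ ∩ C₂ ∩ … ∩ C_r. -/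
open Filter Topology

/-- A nearest point `p` of a convex set to `x` satisfies the firm inequality
`‖p - c‖² + ‖x - p‖² ≤ ‖x - c‖²`. -/
theorem Convex.norm_sub_sq_add_norm_sub_sq_le {E : Type*} [NormedAddCommGroup E]
    [InnerProductSpace ℝ E] {K : Set E} (hK : Convex ℝ K) {x p c : E} (hp : p ∈ K)
    (hmin : ∀ y ∈ K, ‖x - p‖ ≤ ‖x - y‖) (hc : c ∈ K) :
    ‖p - c‖ ^ 2 + ‖x - p‖ ^ 2 ≤ ‖x - c‖ ^ 2 := by
  have : Nonempty K := ⟨⟨p, hp⟩⟩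
  have hinf : ‖x - p‖ = ⨅ w : K, ‖x - w‖ :=
    le_antisymm (le_ciInf fun w => hmin w w.2)
      (ciInf_le (f := fun w : K => ‖x - w‖)
        ⟨0, by rintro _ ⟨w, rfl⟩; exact norm_nonneg _⟩ ⟨p, hp⟩)
  have hinner := (norm_eq_iInf_iff_real_inner_le_zero hK hp).1 hinf c hc
  have hexp := norm_sub_sq_real (x - p) (c - p)
  rw [sub_sub_sub_cancel_right] at hexp
  rw [norm_sub_rev p c]
  linarith

/-- The squared distance from the mean of finitely many vectors to a point is at most the mean
of the squared distances. -/
theorem norm_average_sub_sq_le {E : Type*} [NormedAddCommGroup E] [NormedSpace ℝ E]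
    {r : ℕ} (hr : 0 < r) (v : ℕ → E) (c : E) :
    ‖(r : ℝ)⁻¹ • ∑ i ∈ Finset.range r, v i - c‖ ^ 2 ≤
      (r : ℝ)⁻¹ * ∑ i ∈ Finset.range r, ‖v i - c‖ ^ 2 := by
  have hr' : (0 : ℝ) < r := by exact_mod_cast hr
  have hmean : (r : ℝ)⁻¹ • ∑ i ∈ Finset.range r, v i - c =
      (r : ℝ)⁻¹ • ∑ i ∈ Finset.range r, (v i - c) := by
    rw [Finset.sum_sub_distrib, Finset.sum_const, Finset.card_range, smul_sub,
      ← Nat.cast_smul_eq_nsmul ℝ r c, inv_smul_smul₀ hr'.ne']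
  have hsum : ‖∑ i ∈ Finset.range r, (v i - c)‖ ^ 2 ≤
      r * ∑ i ∈ Finset.range r, ‖v i - c‖ ^ 2 := by
    calc ‖∑ i ∈ Finset.range r, (v i - c)‖ ^ 2
        ≤ (∑ i ∈ Finset.range r, ‖v i - c‖) ^ 2 := by
          gcongr
          exact norm_sum_le _ _
      _ ≤ _ := by simpa using
          sq_sum_le_card_mul_sum_sq (s := Finset.range r) (f := fun i => ‖v i - c‖)
  rw [hmean, norm_smul, mul_pow, Real.norm_of_nonneg (by positivity)]
  calc ((r : ℝ)⁻¹) ^ 2 * ‖∑ i ∈ Finset.range r, (v i - c)‖ ^ 2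
      ≤ ((r : ℝ)⁻¹) ^ 2 * (r * ∑ i ∈ Finset.range r, ‖v i - c‖ ^ 2) := by gcongr
    _ = _ := by field_simp

/-- A sequence in a proper space that is Fejér monotone with respect to a nonempty set `S`
containing all its subsequential limits converges to a point of `S`. -/
theorem exists_tendsto_of_antitone_dist {X : Type*} [PseudoMetricSpace X] [ProperSpace X]
    {S : Set X} (hS : S.Nonempty) {u : ℕ → X}
    (hu : ∀ c ∈ S, Antitone fun k => dist (u k) c)
    (hlim : ∀ φ : ℕ → ℕ, StrictMono φ → ∀ a, Tendsto (u ∘ φ) atTop (𝓝 a) → a ∈ S) :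
    ∃ a ∈ S, Tendsto u atTop (𝓝 a) := by
  obtain ⟨c, hc⟩ := hS
  obtain ⟨a, -, φ, hφ, ha⟩ := tendsto_subseq_of_bounded
    (Metric.isBounded_closedBall (x := c) (r := dist (u 0) c))
    fun k => Metric.mem_closedBall.2 (hu c hc (Nat.zero_le k))
  have haS := hlim φ hφ a ha
  refine ⟨a, haS, tendsto_iff_dist_tendsto_zero.2 ?_⟩
  exact tendsto_iff_tendsto_subseq_of_antitone (hu a haS) hφ.tendsto_atTop |>.2
    (tendsto_iff_dist_tendsto_zero.1 ha)

/-- Method of averaged projections: for closed convex sets with nonempty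
intersection, the iterates of `T = (P_{C₁} + ⋯ + P_{C_r})/r` converge to a point in the
intersection. -/
theorem averaged_projections_converge {E : Type*} [NormedAddCommGroup E]
    [InnerProductSpace ℝ E] [FiniteDimensional ℝ E] (r : ℕ) (hr : 0 < r)
    (C : ℕ → Set E)
    (hC : ∀ i < r, IsClosed (C i) ∧ Convex ℝ (C i))
    (hne : (⋂ i < r, C i).Nonempty)
    (P : ℕ → E → E)
    (hP : ∀ i < r, ∀ x, P i x ∈ C i ∧ ∀ c ∈ C i, ‖x - P i x‖ ≤ ‖x - c‖)
    (T : E → E)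
    (hT : ∀ x, T x = (r : ℝ)⁻¹ • ∑ i ∈ Finset.range r, P i x)
    (x₀ : E) :
    ∃ xs ∈ ⋂ i < r, C i, Tendsto (fun k => T^[k] x₀) atTop (nhds xs) := by
  have hr' : (0 : ℝ) < r := by exact_mod_cast hr
  have hstep : ∀ c ∈ ⋂ i < r, C i, ∀ x,
      ‖T x - c‖ ^ 2 + (r : ℝ)⁻¹ * ∑ i ∈ Finset.range r, ‖x - P i x‖ ^ 2 ≤ ‖x - c‖ ^ 2 := by
    intro c hc x
    rw [Set.mem_iInter₂] at hc
    have hproj : ∑ i ∈ Finset.range r, (‖P i x - c‖ ^ 2 + ‖x - P i x‖ ^ 2) ≤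
        r * ‖x - c‖ ^ 2 := by
      simpa using Finset.sum_le_card_nsmul (Finset.range r)
        (fun i => ‖P i x - c‖ ^ 2 + ‖x - P i x‖ ^ 2) (‖x - c‖ ^ 2) fun i hi => by
          have hi := Finset.mem_range.1 hi
          exact (hC i hi).2.norm_sub_sq_add_norm_sub_sq_le (hP i hi x).1 (hP i hi x).2 (hc i hi)
    calc ‖T x - c‖ ^ 2 + (r : ℝ)⁻¹ * ∑ i ∈ Finset.range r, ‖x - P i x‖ ^ 2
        ≤ (r : ℝ)⁻¹ * ∑ i ∈ Finset.range r, ‖P i x - c‖ ^ 2 +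
          (r : ℝ)⁻¹ * ∑ i ∈ Finset.range r, ‖x - P i x‖ ^ 2 := by
          rw [hT]
          gcongr
          exact norm_average_sub_sq_le hr _ c
      _ = (r : ℝ)⁻¹ * ∑ i ∈ Finset.range r, (‖P i x - c‖ ^ 2 + ‖x - P i x‖ ^ 2) := by
          rw [Finset.sum_add_distrib, mul_add]
      _ ≤ (r : ℝ)⁻¹ * (r * ‖x - c‖ ^ 2) := by gcongr
      _ = ‖x - c‖ ^ 2 := inv_mul_cancel_left₀ hr'.ne' _
  set u : ℕ → E := fun k => T^[k] x₀
  have hsucc : ∀ k, u (k + 1) = T (u k) := fun k => Function.iterate_succ_apply' T k x₀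
  have hanti : ∀ c ∈ ⋂ i < r, C i, Antitone fun k => dist (u k) c := by
    refine fun c hc => antitone_nat_of_succ_le fun k => ?_
    rw [hsucc, dist_eq_norm, dist_eq_norm]
    refine le_of_sq_le_sq ?_ (norm_nonneg _)
    have hnonneg : 0 ≤ (r : ℝ)⁻¹ * ∑ i ∈ Finset.range r, ‖u k - P i (u k)‖ ^ 2 := by positivity
    linarith [hstep c hc (u k)]
  have hres : ∀ i < r, Tendsto (fun k => u k - P i (u k)) atTop (𝓝 0) := by
    intro i hi
    obtain ⟨c, hc⟩ := hne
    have hdist := (tendsto_atTop_ciInf (hanti c hc)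
      ⟨0, by rintro _ ⟨k, rfl⟩; exact dist_nonneg⟩).pow 2
    have hdiff := (hdist.sub (hdist.comp (tendsto_add_atTop_nat 1))).const_mul (r : ℝ)
    rw [sub_self, mul_zero] at hdiff
    have hsq : Tendsto (fun k => ‖u k - P i (u k)‖ ^ 2) atTop (𝓝 0) := by
      refine squeeze_zero (fun k => sq_nonneg _) (fun k => ?_) hdiff
      have hsingle := Finset.single_le_sum (f := fun j => ‖u k - P j (u k)‖ ^ 2)
        (fun j _ => sq_nonneg _) (Finset.mem_range.2 hi)
      refine hsingle.trans ?_
      rw [← inv_mul_le_iff₀ hr']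
      simp only [Function.comp_apply, dist_eq_norm, hsucc]
      linarith [hstep c hc (u k)]
    rw [tendsto_zero_iff_norm_tendsto_zero]
    simpa [Real.sqrt_sq] using hsq.sqrt
  refine exists_tendsto_of_antitone_dist hne hanti fun φ hφ a ha => ?_
  refine Set.mem_iInter₂.2 fun i hi => ?_
  have hlim : Tendsto (fun k => P i (u (φ k))) atTop (𝓝 a) := by
    simpa using ha.sub ((hres i hi).comp hφ.tendsto_atTop)
  exact (hC i hi).1.mem_of_tendsto hlim (Eventually.of_forall fun k => (hP i hi _).1)
end
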